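/- For any (η_0, η_1) ∈ ℝ² with η_0 < k log ρ^{−1} and η_1 < (k/(k−1)) log ρ^{−1} = log ρ^{−1} + (1/(k−1)) log ρ^{−1}, the stationary moment generating function satisfies φ(η_0, η_1𝟙) < ∞. -/

import Mathlib

open Filter Topology
open scoped ENNReal

noncomputable section

/-- Traffic intensity ρ = λ / Σ μᵢ. -/
def rho (k : ℕ) (lam : ℝ) (μ : Fin k → ℝ) : ℝ := lam / ∑ i, μ i

/-- Index set of the shortest queues: the zero coordinates of the difference vector. -/
def zeroSet (k : ℕ) (y : Fin k → ℕ) : Finset (Fin k) :=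
  Finset.univ.filter (fun i => y i = 0)

/-- One-step transition probability of the uniformized JSQ chain `Z = (M, Y)` on
`ℕ × (Fin k → ℕ)`, where `M` is the minimum queue length and `Y` the vector of
differences from the minimum. -/
def jsqP (k : ℕ) (lam : ℝ) (μ : Fin k → ℝ) (s s' : ℕ × (Fin k → ℕ)) : ℝ :=
  (if (zeroSet k s.2).card = 1 then
      (if s' = (s.1 + 1, fun j => s.2 j - 1) then lam else 0)
    else
      ∑ i ∈ zeroSet k s.2,
        (if s' = (s.1, Function.update s.2 i 1) then lam / (zeroSet k s.2).card else 0))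
  + (∑ j ∈ (zeroSet k s.2)ᶜ,
      (if s' = (s.1, Function.update s.2 j (s.2 j - 1)) then μ j else 0))
  + (∑ i ∈ zeroSet k s.2,
      (if s' = (if s.1 = 0 then s else (s.1 - 1, fun j => if j = i then 0 else s.2 j + 1))
        then μ i else 0))

/-- The exponential weight `e^{θ·Z}` for `θ ∈ ℝ^{k+1}` and a state `Z = (m, y)`. -/
def expWeight (k : ℕ) (θ : Fin (k + 1) → ℝ) (s : ℕ × (Fin k → ℕ)) : ℝ :=
  Real.exp (θ 0 * (s.1 : ℝ) + ∑ i : Fin k, θ i.succ * (s.2 i : ℝ))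

/-- The stationary moment generating function `φ(θ) = E[e^{θ·Z}] ∈ [0,∞]`. -/
def phi (k : ℕ) (π : ℕ × (Fin k → ℕ) → ℝ) (θ : Fin (k + 1) → ℝ) : ℝ≥0∞ :=
  ∑' s : ℕ × (Fin k → ℕ), ENNReal.ofReal (π s * expWeight k θ s)

/-- `φ_{+U}(θ) = E[e^{θ·Z} 1(Z ∈ S_{+U})]`. -/
def phiPlus (k : ℕ) (π : ℕ × (Fin k → ℕ) → ℝ) (U : Finset (Fin k))
    (θ : Fin (k + 1) → ℝ) : ℝ≥0∞ :=
  ∑' s : ℕ × (Fin k → ℕ),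
    if 1 ≤ s.1 ∧ zeroSet k s.2 = U then ENNReal.ofReal (π s * expWeight k θ s) else 0

/-- `φ_{0U}(θ) = E[e^{θ·Z} 1(Z ∈ S_{0U})]`. -/
def phiZero (k : ℕ) (π : ℕ × (Fin k → ℕ) → ℝ) (U : Finset (Fin k))
    (θ : Fin (k + 1) → ℝ) : ℝ≥0∞ :=
  ∑' s : ℕ × (Fin k → ℕ),
    if s.1 = 0 ∧ zeroSet k s.2 = U then ENNReal.ofReal (π s * expWeight k θ s) else 0

/-- The mgf `γ_{+U}(θ)` of the one-step increment from states in `S_{+U}`. -/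
def gammaPlus (k : ℕ) (lam : ℝ) (μ : Fin k → ℝ) (U : Finset (Fin k))
    (θ : Fin (k + 1) → ℝ) : ℝ :=
  (if U.card = 1 then lam * Real.exp (θ 0 - ∑ j ∈ Uᶜ, θ j.succ)
    else ∑ i ∈ U, (lam / U.card) * Real.exp (θ i.succ))
  + ∑ j ∈ Uᶜ, μ j * Real.exp (-θ j.succ)
  + ∑ i ∈ U, μ i * Real.exp (-θ 0 + ∑ j ∈ Finset.univ.erase i, θ j.succ)

/-- The mgf `γ_{0U}(θ)` of the one-step increment from states in `S_{0U}`. -/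
def gammaZero (k : ℕ) (lam : ℝ) (μ : Fin k → ℝ) (U : Finset (Fin k))
    (θ : Fin (k + 1) → ℝ) : ℝ :=
  (if U.card = 1 then lam * Real.exp (θ 0 - ∑ j ∈ Uᶜ, θ j.succ)
    else ∑ i ∈ U, (lam / U.card) * Real.exp (θ i.succ))
  + ∑ j ∈ Uᶜ, μ j * Real.exp (-θ j.succ)
  + ∑ i ∈ U, μ i

end

/-- Foster–Lyapunov bound: a drift inequality `P V ≤ V - f + C` on the support of a stationary
summable weight `π` makes `f` integrable against `π`. -/
theorem summable_mul_of_drift {S : Type*} {π : S → ℝ} {P : S → S → ℝ} {V f : S → ℝ} {C : ℝ}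
    (hπ0 : ∀ s, 0 ≤ π s) (hπ : Summable π) (hP0 : ∀ s s', 0 ≤ P s s')
    (hP1 : ∀ s, π s ≠ 0 → HasSum (P s) 1)
    (hstat : ∀ s', (∑' s, π s * P s s') = π s')
    (hV0 : ∀ s, 0 ≤ V s) (hf0 : ∀ s, 0 ≤ f s) (hC : 0 ≤ C)
    (hdrift : ∀ s, π s ≠ 0 →
      ∃ v, HasSum (fun s' => P s s' * V s') v ∧ v ≤ V s - f s + C) :
    Summable (fun s => π s * f s) := by
  have hrow : ∀ s, HasSum (fun s' => π s * P s s') (π s) := by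
    intro s
    by_cases h : π s = 0
    · simp [h, hasSum_zero]
    · simpa using (hP1 s h).mul_left (π s)
  have hw0 : ∀ p : S × S, 0 ≤ π p.1 * P p.1 p.2 := fun p => mul_nonneg (hπ0 _) (hP0 _ _)
  have hw : Summable (fun p : S × S => π p.1 * P p.1 p.2) := by
    refine (summable_prod_of_nonneg hw0).2 ⟨fun s => (hrow s).summable, ?_⟩
    exact hπ.congr fun s => (hrow s).tsum_eq.symm
  refine summable_of_sum_le (c := C * ∑' s, π s) (fun s => mul_nonneg (hπ0 s) (hf0 s)) fun F => ?_
  obtain ⟨n, hn⟩ : ∃ n : ℝ, ∀ s ∈ F, V s ≤ n :=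
    ⟨∑ s ∈ F, V s, fun s hs => Finset.single_le_sum (fun i _ => hV0 i) hs⟩
  let n' := max n 0
  let G : S → ℝ := fun s => min (V s) n'
  have hG0 : ∀ s, 0 ≤ G s := fun s => le_min (hV0 s) (le_max_right _ _)
  have hGn : ∀ s, G s ≤ n' := fun s => min_le_right _ _
  have hwG : Summable (fun p : S × S => π p.1 * P p.1 p.2 * G p.2) :=
    Summable.of_nonneg_of_le (fun p => mul_nonneg (hw0 p) (hG0 _))
      (fun p => mul_le_mul_of_nonneg_left (hGn _) (hw0 p)) (hw.mul_right n')
  have hπG : Summable (fun s => π s * G s) :=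
    Summable.of_nonneg_of_le (fun s => mul_nonneg (hπ0 s) (hG0 _))
      (fun s => mul_le_mul_of_nonneg_left (hGn _) (hπ0 s)) (hπ.mul_right n')
  have hT : Summable (fun s => ∑' s', π s * P s s' * G s') := hwG.prod
  have hTsum : (∑' s, ∑' s', π s * P s s' * G s') = ∑' s, π s * G s := by
    refine (Summable.tsum_comm (f := fun s s' => π s * P s s' * G s') hwG).symm.trans ?_
    exact tsum_congr fun s' => by rw [tsum_mul_right, hstat]
  have hrowG : ∀ s, Summable (fun s' => π s * P s s' * G s') := fun s => hwG.prod_factor s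
  have hle_n : ∀ s, (∑' s', π s * P s s' * G s') ≤ π s * n' := fun s => by
    rw [← ((hrow s).mul_right n').tsum_eq]
    exact (hrowG s).tsum_le_tsum
      (fun s' => mul_le_mul_of_nonneg_left (hGn _) (hw0 (s, s'))) ((hrow s).mul_right n').summable
  have hle_V : ∀ s, (∑' s', π s * P s s' * G s') ≤ π s * (V s - f s + C) := fun s => by
    by_cases h : π s = 0
    · simp [h]
    · obtain ⟨v, hv, hvle⟩ := hdrift s h
      have hv' := hv.mul_left (π s)
      refine le_trans ?_ (mul_le_mul_of_nonneg_left hvle (hπ0 s))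
      rw [← hv'.tsum_eq]
      refine (hrowG s).tsum_le_tsum (fun s' => ?_) hv'.summable
      rw [mul_assoc]
      exact mul_le_mul_of_nonneg_left
        (mul_le_mul_of_nonneg_left (min_le_left _ _) (hP0 _ _)) (hπ0 s)
  let R : S → ℝ := fun s => π s * G s - (∑' s', π s * P s s' * G s') + C * π s
  have hR : Summable R := (hπG.sub hT).add (hπ.mul_left C)
  have hRsum : ∑' s, R s = C * ∑' s, π s := by
    rw [(hπG.sub hT).tsum_add (hπ.mul_left C), hπG.tsum_sub hT, hTsum, tsum_mul_left]
    ring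
  have hR_of_le : ∀ s, V s ≤ n' → π s * f s ≤ R s := fun s hs => by
    have h1 := hle_V s
    have h2 : G s = V s := min_eq_left hs
    simp only [R, h2]
    linarith
  have hR0 : ∀ s, 0 ≤ R s := fun s => by
    rcases le_total (V s) n' with hs | hs
    · exact (mul_nonneg (hπ0 s) (hf0 s)).trans (hR_of_le s hs)
    · have h2 : G s = n' := min_eq_right hs
      have h1 := hle_n s
      have h3 := mul_nonneg hC (hπ0 s)
      simp only [R, h2]
      linarith
  calc ∑ s ∈ F, π s * f s ≤ ∑ s ∈ F, R s :=
        Finset.sum_le_sum fun s hs => hR_of_le s ((hn s hs).trans (le_max_left _ _))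
    _ ≤ ∑' s, R s := hR.sum_le_tsum F fun s _ => hR0 s
    _ = C * ∑' s, π s := hRsum

theorem jsqP_nonneg {k : ℕ} {lam : ℝ} {μ : Fin k → ℝ} (hlam : 0 ≤ lam) (hμ : ∀ i, 0 ≤ μ i)
    (s s' : ℕ × (Fin k → ℕ)) : 0 ≤ jsqP k lam μ s s' := by
  unfold jsqP
  refine add_nonneg (add_nonneg ?_ ?_) ?_
  · split_ifs
    · exact hlam
    · exact le_rfl
    · refine Finset.sum_nonneg fun i _ => ?_
      split_ifs
      · positivity
      · exact le_rfl
  · exact Finset.sum_nonneg fun i _ => by split_ifs <;> simp [hμ]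
  · exact Finset.sum_nonneg fun i _ => by split_ifs <;> simp [hμ]

theorem hasSum_ite_eq_mul {S : Type*} [DecidableEq S] (a : S) (c : ℝ) (G : S → ℝ) :
    HasSum (fun s' => (if s' = a then c else 0) * G s') (c * G a) := by
  have h := hasSum_single (f := fun s' => (if s' = a then c else 0) * G s') a
    (fun b hb => by simp [hb])
  simpa using h

theorem hasSum_jsqP_mul {k : ℕ} (lam : ℝ) (μ : Fin k → ℝ) (s : ℕ × (Fin k → ℕ))
    (G : ℕ × (Fin k → ℕ) → ℝ) :
    HasSum (fun s' => jsqP k lam μ s s' * G s')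
      ((if (zeroSet k s.2).card = 1 then lam * G (s.1 + 1, fun j => s.2 j - 1)
        else ∑ i ∈ zeroSet k s.2,
          lam / (zeroSet k s.2).card * G (s.1, Function.update s.2 i 1))
      + (∑ j ∈ (zeroSet k s.2)ᶜ, μ j * G (s.1, Function.update s.2 j (s.2 j - 1)))
      + (∑ i ∈ zeroSet k s.2,
          μ i * G (if s.1 = 0 then s else (s.1 - 1, fun j => if j = i then 0 else s.2 j + 1)))) := by
  simp only [jsqP, add_mul, Finset.sum_mul]
  refine HasSum.add (HasSum.add ?_ ?_) ?_
  · split_ifs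
    · exact hasSum_ite_eq_mul _ _ _
    · simp only [Finset.sum_mul]
      exact hasSum_sum fun i _ => hasSum_ite_eq_mul _ _ _
  · exact hasSum_sum fun i _ => hasSum_ite_eq_mul _ _ _
  · exact hasSum_sum fun i _ => hasSum_ite_eq_mul _ _ _

theorem mem_zeroSet {k : ℕ} {y : Fin k → ℕ} {i : Fin k} : i ∈ zeroSet k y ↔ y i = 0 := by
  simp [zeroSet]

/-- The vector of queue lengths in the state `s = (m, y)`. -/
noncomputable def queueLen (k : ℕ) (s : ℕ × (Fin k → ℕ)) (j : Fin k) : ℝ := (s.1 : ℝ) + s.2 j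

/-- If `G` changes by `a` when a shortest queue receives a customer and by `b j` when a customer
leaves queue `j`, then `P G` is `G` plus the mean change. -/
theorem hasSum_jsqP_mul_queueLen {k : ℕ} {lam : ℝ} {μ : Fin k → ℝ} {s : ℕ × (Fin k → ℕ)}
    {W : (Fin k → ℝ) → ℝ} (hnorm : lam + ∑ i, μ i = 1) (hs : ∃ i, s.2 i = 0)
    {a : ℝ} {b : Fin k → ℝ}
    (ha : ∀ i, s.2 i = 0 →
      W (Function.update (queueLen k s) i (queueLen k s i + 1)) = W (queueLen k s) + a)
    (hb : ∀ i, W (Function.update (queueLen k s) i (queueLen k s i - 1)) =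
      W (queueLen k s) + b i) :
    HasSum (fun s' => jsqP k lam μ s s' * W (queueLen k s'))
      (W (queueLen k s) + lam * a
        + ∑ j, μ j * (if s.1 + s.2 j = 0 then 0 else b j)) := by
  have h := hasSum_jsqP_mul lam μ s (fun s' => W (queueLen k s'))
  convert h using 1
  set w := W (queueLen k s)
  have h1 : (if (zeroSet k s.2).card = 1 then lam * W (queueLen k (s.1 + 1, fun j => s.2 j - 1))
        else ∑ i ∈ zeroSet k s.2,
          lam / (zeroSet k s.2).card * W (queueLen k (s.1, Function.update s.2 i 1)))
      = lam * (w + a) := by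
    split_ifs with hc
    · obtain ⟨i, hi⟩ := Finset.card_eq_one.1 hc
      have hi0 : s.2 i = 0 := mem_zeroSet.1 (by simp [hi])
      rw [← ha i hi0]
      congr 2
      ext j
      by_cases hj : j = i
      · subst hj; simp [queueLen, hi0]
      · have hj0 : s.2 j ≠ 0 := fun h0 => hj (by simpa [hi] using mem_zeroSet.2 h0)
        have : 1 ≤ s.2 j := by omega
        simp [queueLen, hj, Nat.cast_sub this]
    · have hcard : ((zeroSet k s.2).card : ℝ) ≠ 0 := by
        obtain ⟨i, hi⟩ := hs
        exact_mod_cast Finset.card_ne_zero_of_mem (mem_zeroSet.2 hi)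
      have : ∀ i ∈ zeroSet k s.2,
          lam / (zeroSet k s.2).card * W (queueLen k (s.1, Function.update s.2 i 1))
            = lam / (zeroSet k s.2).card * (w + a) := by
        intro i hi
        rw [← ha i (mem_zeroSet.1 hi)]
        congr 2
        ext j
        by_cases hj : j = i
        · subst hj; simp [queueLen, mem_zeroSet.1 hi]
        · simp [queueLen, hj]
      rw [Finset.sum_congr rfl this, Finset.sum_const, nsmul_eq_mul]
      field_simp
  have h2 : ∀ j ∈ (zeroSet k s.2)ᶜ,
      μ j * W (queueLen k (s.1, Function.update s.2 j (s.2 j - 1)))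
        = μ j * (w + if s.1 + s.2 j = 0 then 0 else b j) := by
    intro j hj
    have hj0 : s.2 j ≠ 0 := by simpa [mem_zeroSet] using hj
    rw [if_neg (by omega), ← hb j]
    congr 2
    ext l
    by_cases hl : l = j
    · subst hl
      simp [queueLen, Nat.cast_sub (show 1 ≤ s.2 l by omega), add_sub_assoc]
    · simp [queueLen, hl]
  have h3 : ∀ i ∈ zeroSet k s.2,
      μ i * W (queueLen k
          (if s.1 = 0 then s else (s.1 - 1, fun j => if j = i then 0 else s.2 j + 1)))
        = μ i * (w + if s.1 + s.2 i = 0 then 0 else b i) := by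
    intro i hi
    have hi0 := mem_zeroSet.1 hi
    by_cases hm : s.1 = 0
    · simp [hm, hi0, w]
    · rw [if_neg hm, if_neg (by omega), ← hb i]
      congr 2
      ext l
      by_cases hl : l = i
      · subst hl
        simp [queueLen, hi0, Nat.cast_sub (show 1 ≤ s.1 by omega)]
      · simp [queueLen, hl, Nat.cast_sub (show 1 ≤ s.1 by omega)]
  rw [h1, Finset.sum_congr rfl h2, Finset.sum_congr rfl h3, add_assoc (lam * (w + a)),
    Finset.sum_compl_add_sum]
  simp only [mul_add, Finset.sum_add_distrib, ← Finset.sum_mul]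
  linear_combination (-w) * hnorm

/-- The Lyapunov function `e^{s Σ q} + A Σ e^{t q_j}` of the queue lengths. -/
noncomputable def lyapunov (k : ℕ) (r t A : ℝ) (q : Fin k → ℝ) : ℝ :=
  Real.exp (r * ∑ j, q j) + A * ∑ j, Real.exp (t * q j)

theorem lyapunov_update (k : ℕ) (r t A : ℝ) (q : Fin k → ℝ) (i : Fin k) (d : ℝ) :
    lyapunov k r t A (Function.update q i (q i + d)) = lyapunov k r t A q +
      (Real.exp (r * ∑ j, q j) * (Real.exp (r * d) - 1)
        + A * (Real.exp (t * q i) * (Real.exp (t * d) - 1))) := by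
  have h1 : ∑ j, Function.update q i (q i + d) j = ∑ j, q j + d := by
    rw [Finset.sum_update_of_mem (Finset.mem_univ i),
      ← Finset.add_sum_erase Finset.univ q (Finset.mem_univ i), Finset.sdiff_singleton_eq_erase]
    ring
  have h2 : ∑ j, Real.exp (t * Function.update q i (q i + d) j)
      = ∑ j, Real.exp (t * q j) + Real.exp (t * q i) * (Real.exp (t * d) - 1) := by
    rw [← Finset.add_sum_erase Finset.univ _ (Finset.mem_univ i),
      ← Finset.add_sum_erase Finset.univ (fun j => Real.exp (t * q j)) (Finset.mem_univ i),
      Finset.sum_congr rfl (g := fun j => Real.exp (t * q j))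
        (fun j hj => by rw [Function.update_of_ne (Finset.ne_of_mem_erase hj)])]
    simp only [Function.update_self, mul_add, Real.exp_add]
    ring
  simp only [lyapunov, h1, h2, mul_add, Real.exp_add]
  ring

theorem mul_pow_le_mul_pow_succ_add {a b : ℝ} (ha : 0 ≤ a) (hb : 0 < b) (n : ℕ) {z : ℝ}
    (hz : 0 ≤ z) : a * z ^ n ≤ b * z ^ (n + 1) + a * (a / b) ^ n := by
  rcases le_total z (a / b) with h | h
  · have : a * z ^ n ≤ a * (a / b) ^ n := by gcongr
    have : 0 ≤ b * z ^ (n + 1) := by positivity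
    linarith
  · have h1 : a ≤ b * z := by rwa [div_le_iff₀' hb] at h
    have h2 : a * z ^ n ≤ b * z * z ^ n := by gcongr
    have h3 : 0 ≤ a * (a / b) ^ n := by positivity
    rw [pow_succ]
    linarith

/-- When some queue is empty, the total is at most `k - 1` times the longest queue. -/
theorem exp_mul_sum_le_pow {n : ℕ} {r : ℝ} (hr : 0 ≤ r) {q : Fin (n + 1) → ℝ} {i j : Fin (n + 1)}
    (hi : q i = 0) (hj : ∀ l, q l ≤ q j) :
    Real.exp (r * ∑ l, q l) ≤ Real.exp (r * q j) ^ n := by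
  rw [← Real.exp_nat_mul, Real.exp_le_exp]
  have : ∑ l, q l ≤ n * q j := by
    rw [← Finset.add_sum_erase Finset.univ q (Finset.mem_univ i), hi, zero_add]
    simpa using Finset.sum_le_card_nsmul (Finset.univ.erase i) q (q j) (fun l _ => hj l)
  nlinarith

/-- Summability of `e^{t q_j}` summed over all queues, for `t = k r` with `r < log ρ⁻¹`. -/
theorem summable_jsq_exp_queueLen {n : ℕ} {lam : ℝ} {μ : Fin (n + 1) → ℝ}
    (hlam : 0 < lam) (hμ : ∀ i, 0 < μ i) (hnorm : lam + ∑ i, μ i = 1)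
    {π : ℕ × (Fin (n + 1) → ℕ) → ℝ} (hπnn : ∀ s, 0 ≤ π s)
    (hπsupp : ∀ s, π s ≠ 0 → ∃ i, s.2 i = 0) (hπsum : Summable π)
    (hπstat : ∀ s', (∑' s, π s * jsqP (n + 1) lam μ s s') = π s')
    {r : ℝ} (hr : 0 < r) (hrlt : lam * Real.exp r < ∑ i, μ i) :
    Summable (fun s => π s * ∑ j, Real.exp ((n + 1) * r * queueLen (n + 1) s j)) := by
  set t : ℝ := (n + 1) * r with ht
  have ht0 : 0 < t := by positivity
  obtain ⟨c, hc0, hc⟩ : ∃ c, 0 < c ∧ ∀ i, c ≤ μ i := by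
    obtain ⟨i, hi⟩ := Finite.exists_min μ
    exact ⟨μ i, hμ i, hi⟩
  have her : 0 < Real.exp r - 1 := by linarith [Real.one_lt_exp_iff.2 hr]
  have het : 0 < Real.exp t - 1 := by linarith [Real.one_lt_exp_iff.2 ht0]
  have her' : 0 < 1 - Real.exp (-r) := by
    linarith [Real.exp_lt_one_iff.2 (show -r < 0 by linarith)]
  have het' : 0 < 1 - Real.exp (-t) := by
    linarith [Real.exp_lt_one_iff.2 (show -t < 0 by linarith)]
  have hprod : Real.exp r * (1 - Real.exp (-r)) = Real.exp r - 1 := by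
    rw [mul_sub, ← Real.exp_add]; simp
  set ε : ℝ := (1 - Real.exp (-r)) * (∑ i, μ i - lam * Real.exp r) with hε
  have hε0 : 0 < ε := mul_pos her' (by linarith)
  set A : ℝ := ε / (lam * (Real.exp t - 1)) with hA
  have hA0 : 0 < A := by positivity
  have hAε : A * (lam * (Real.exp t - 1)) = ε := div_mul_cancel₀ _ (by positivity)
  set B : ℝ := A * (1 - Real.exp (-t)) * c with hB
  have hB0 : 0 < B := by positivity
  set a₀ : ℝ := lam * (Real.exp r - 1) with ha₀
  have ha₀0 : 0 < a₀ := by positivity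
  set K : ℝ := a₀ * (a₀ / (B / 2)) ^ n with hK
  have hK0 : 0 < K := by positivity
  set C : ℝ := K + ε + B * (n + 1) with hC
  have key : Summable (fun s => π s *
      (B / 2 * ∑ j, Real.exp (t * queueLen (n + 1) s j))) := by
    refine summable_mul_of_drift (P := jsqP (n + 1) lam μ) (C := C)
      (V := fun s => lyapunov (n + 1) r t A (queueLen (n + 1) s)) hπnn hπsum
      (jsqP_nonneg hlam.le fun i => (hμ i).le) ?_ hπstat ?_ ?_ (by positivity) ?_
    · intro s hs
      simpa using hasSum_jsqP_mul_queueLen (W := fun _ => 1) (a := 0) (b := 0) hnorm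
        (hπsupp s hs) (by simp) (by simp)
    · intro s
      unfold lyapunov
      positivity
    · intro s
      positivity
    · intro s hs
      obtain ⟨i₀, hi₀⟩ := hπsupp s hs
      set q := queueLen (n + 1) s with hq
      set X := Real.exp (r * ∑ j, q j) with hX
      have hX0 : 0 < X := Real.exp_pos _
      set F := ∑ j, Real.exp (t * q j) with hF
      refine ⟨_, hasSum_jsqP_mul_queueLen (W := lyapunov (n + 1) r t A)
        (a := X * (Real.exp r - 1) + A * (Real.exp (t * s.1) * (Real.exp t - 1)))
        (b := fun j => X * (Real.exp (-r) - 1) + A * (Real.exp (t * q j) * (Real.exp (-t) - 1)))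
        hnorm ⟨i₀, hi₀⟩ (fun i hi => ?_) (fun i => ?_), ?_⟩
      · rw [lyapunov_update]
        simp [queueLen, hi, hX, hq]
      · rw [sub_eq_add_neg, lyapunov_update]
        simp [hX, hq]
      · rw [← hq]
        have hq0 : ∀ j, 0 ≤ q j := fun j => by simp only [hq, queueLen]; positivity
        by_cases hm : s.1 = 0
        · obtain ⟨j₀, hj₀⟩ := Finite.exists_max q
          have hXle : a₀ * X ≤ B / 2 * F + K := by
            have h1 : X ≤ Real.exp (r * q j₀) ^ n :=
              exp_mul_sum_le_pow hr.le (i := i₀) (by simp [hq, queueLen, hm, hi₀]) hj₀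
            have h2 := mul_pow_le_mul_pow_succ_add ha₀0.le (half_pos hB0) n
              (Real.exp_pos (r * q j₀)).le
            have h3 : Real.exp (r * q j₀) ^ (n + 1) ≤ F := by
              rw [← Real.exp_nat_mul, hF]
              have : ((n + 1 : ℕ) : ℝ) * (r * q j₀) = t * q j₀ := by rw [ht]; push_cast; ring
              rw [this]
              exact Finset.single_le_sum (f := fun j => Real.exp (t * q j))
                (fun j _ => (Real.exp_pos _).le) (Finset.mem_univ j₀)
            have h4 := mul_le_mul_of_nonneg_left h1 ha₀0.le
            have h5 := mul_le_mul_of_nonneg_left h3 (half_pos hB0).le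
            linarith
          have hdep : ∑ j, μ j * (if s.1 + s.2 j = 0 then 0 else
              X * (Real.exp (-r) - 1) + A * (Real.exp (t * q j) * (Real.exp (-t) - 1)))
              ≤ ∑ j, (B - B * Real.exp (t * q j)) := by
            refine Finset.sum_le_sum fun j _ => ?_
            split_ifs with h0
            · have : q j = 0 := by
                simp only [hq, queueLen]; exact_mod_cast h0
              simp [this]
            · have h1 : c * (A * (Real.exp (t * q j) * (1 - Real.exp (-t)))) ≤
                  μ j * (A * (Real.exp (t * q j) * (1 - Real.exp (-t)))) :=
                mul_le_mul_of_nonneg_right (hc j) (by positivity)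
              have h2 : 0 ≤ μ j * (X * (1 - Real.exp (-r))) :=
                mul_nonneg (hμ j).le (by positivity)
              rw [hB]
              nlinarith
          simp only [Finset.sum_sub_distrib, ← Finset.mul_sum, Finset.sum_const,
            Finset.card_univ, Fintype.card_fin, nsmul_eq_mul] at hdep
          rw [← hF] at hdep
          simp only [hm, Nat.cast_zero, mul_zero, Real.exp_zero, one_mul] at hdep ⊢
          push_cast at hdep
          rw [hC]
          nlinarith
        · have hXM : Real.exp (t * s.1) ≤ X := by
            rw [hX, Real.exp_le_exp]
            have : ∑ _j : Fin (n + 1), (s.1 : ℝ) ≤ ∑ j, q j :=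
              Finset.sum_le_sum fun j _ => by simp [hq, queueLen]
            simp only [Finset.sum_const, Finset.card_univ, Fintype.card_fin, nsmul_eq_mul] at this
            push_cast at this
            rw [ht]
            nlinarith
          have hdep : ∑ j, μ j * (if s.1 + s.2 j = 0 then 0 else
              X * (Real.exp (-r) - 1) + A * (Real.exp (t * q j) * (Real.exp (-t) - 1)))
              ≤ ∑ j, (μ j * (X * (Real.exp (-r) - 1)) - B * Real.exp (t * q j)) := by
            refine Finset.sum_le_sum fun j _ => ?_
            rw [if_neg (by omega)]
            have h1 : c * (A * (Real.exp (t * q j) * (1 - Real.exp (-t)))) ≤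
                  μ j * (A * (Real.exp (t * q j) * (1 - Real.exp (-t)))) :=
              mul_le_mul_of_nonneg_right (hc j) (by positivity)
            rw [hB]
            linarith
          rw [Finset.sum_sub_distrib, ← Finset.mul_sum, ← Finset.sum_mul, ← hF] at hdep
          have h1 : lam * (A * (Real.exp (t * s.1) * (Real.exp t - 1))) ≤ ε * X := by
            rw [← hAε]
            have := mul_le_mul_of_nonneg_left hXM
              (show 0 ≤ A * (lam * (Real.exp t - 1)) by positivity)
            linarith
          have h2 : lam * (X * (Real.exp r - 1)) + (∑ j, μ j) * (X * (Real.exp (-r) - 1))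
              = -(ε * X) := by
            rw [hε, ← hprod]; ring
          have hF0 : 0 ≤ F := by positivity
          have h3 : 0 ≤ B * F := by positivity
          have h4 : 0 ≤ B * (n + 1) := by positivity
          rw [hC]
          linarith
  have := key.mul_left (B / 2)⁻¹
  refine this.congr fun s => ?_
  field_simp

theorem expWeight_le_sum_exp {n : ℕ} (hn : 0 < n) {η₀ η₁ t : ℝ} (ht : 0 ≤ t) (h₀ : η₀ ≤ t)
    (h₁ : n * η₁ ≤ t) {s : ℕ × (Fin (n + 1) → ℕ)} (hs : ∃ i, s.2 i = 0) :
    expWeight (n + 1) (Fin.cons η₀ (fun _ => η₁)) s ≤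
      ∑ j, Real.exp (t * queueLen (n + 1) s j) := by
  obtain ⟨i, hi⟩ := hs
  obtain ⟨j, hj⟩ := Finite.exists_max s.2
  refine le_trans ?_ (Finset.single_le_sum (f := fun j => Real.exp (t * queueLen (n + 1) s j))
    (fun j _ => (Real.exp_pos _).le) (Finset.mem_univ j))
  simp only [expWeight, Fin.cons_zero, Fin.cons_succ, ← Finset.mul_sum, queueLen]
  rw [Real.exp_le_exp]
  have hsum : ∑ l, (s.2 l : ℝ) ≤ n * s.2 j := by
    rw [← Finset.add_sum_erase Finset.univ _ (Finset.mem_univ i), hi, Nat.cast_zero, zero_add]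
    simpa using Finset.sum_le_card_nsmul (Finset.univ.erase i) (fun l => (s.2 l : ℝ)) (s.2 j)
      (fun l _ => by exact_mod_cast hj l)
  have hsum0 : 0 ≤ ∑ l, (s.2 l : ℝ) := by positivity
  have hn' : (0 : ℝ) < n := by exact_mod_cast hn
  have h2 : η₁ * ∑ l, (s.2 l : ℝ) ≤ t * s.2 j := by
    have h3 : η₁ ≤ t / n := by rwa [le_div_iff₀' hn']
    calc η₁ * ∑ l, (s.2 l : ℝ) ≤ t / n * ∑ l, (s.2 l : ℝ) := by gcongr
      _ ≤ t / n * (n * s.2 j) := by gcongr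
      _ = t * s.2 j := by field_simp
  have h4 : η₀ * (s.1 : ℝ) ≤ t * s.1 := by gcongr
  linarith

/-- **Convergence domain of the stationary mgf (Lemma on the domain `𝒟`):**
if `η₀ < k log ρ⁻¹` and `η₁ < (k/(k−1)) log ρ⁻¹ = log ρ⁻¹ + (1/(k−1)) log ρ⁻¹`,
then `φ(η₀, η₁𝟙) < ∞`. -/
theorem jsq_domain_of_convergence
    (k : ℕ) (hk : 2 ≤ k) (lam : ℝ) (μ : Fin k → ℝ)
    (hlam : 0 < lam) (hμ : ∀ i, 0 < μ i)
    (hnorm : lam + ∑ i, μ i = 1)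
    (hρ : rho k lam μ < 1)
    (π : ℕ × (Fin k → ℕ) → ℝ)
    (hπnn : ∀ s, 0 ≤ π s)
    (hπsupp : ∀ s, π s ≠ 0 → ∃ i : Fin k, s.2 i = 0)
    (hπsum : HasSum π 1)
    (hπstat : ∀ s', (∑' s, π s * jsqP k lam μ s s') = π s')
    (η₀ η₁ : ℝ)
    (hη₀ : η₀ < (k : ℝ) * Real.log (rho k lam μ)⁻¹)
    (hη₁ : η₁ < ((k : ℝ) / ((k : ℝ) - 1)) * Real.log (rho k lam μ)⁻¹) :
    phi k π (Fin.cons η₀ (fun _ => η₁)) < ⊤ := by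
  obtain ⟨n, rfl⟩ : ∃ n, k = n + 1 := ⟨k - 1, by omega⟩
  have hn : 0 < n := by omega
  have hn' : (0 : ℝ) < n := by exact_mod_cast hn
  have hμpos : 0 < ∑ i, μ i := Finset.sum_pos (fun i _ => hμ i) Finset.univ_nonempty
  have hρ0 : 0 < rho (n + 1) lam μ := div_pos hlam hμpos
  set ℓ := Real.log (rho (n + 1) lam μ)⁻¹ with hℓ
  have hℓ0 : 0 < ℓ := Real.log_pos ((one_lt_inv₀ hρ0).2 hρ)
  push_cast at hη₀ hη₁
  rw [add_sub_cancel_right] at hη₁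
  have hη₁' : n * η₁ / (n + 1) < ℓ := by
    rw [div_lt_iff₀ (by positivity)]
    calc n * η₁ < n * ((n + 1) / n * ℓ) := by gcongr
      _ = ℓ * (n + 1) := by field_simp
  have hη₀' : η₀ / (n + 1) < ℓ := by
    rw [div_lt_iff₀ (by positivity)]
    linarith
  obtain ⟨r, hr, hrℓ⟩ := exists_between (max_lt (max_lt hη₀' hη₁') hℓ0)
  simp only [max_lt_iff] at hr
  obtain ⟨⟨hr₀, hr₁⟩, hr0⟩ := hr
  rw [div_lt_iff₀ (by positivity)] at hr₀ hr₁
  have hrlt : lam * Real.exp r < ∑ i, μ i := by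
    have h1 := Real.exp_lt_exp.2 hrℓ
    rw [hℓ, Real.exp_log (inv_pos.2 hρ0), rho, inv_div, lt_div_iff₀ hlam] at h1
    linarith
  have hsum := summable_jsq_exp_queueLen hlam hμ hnorm hπnn hπsupp hπsum.summable hπstat hr0 hrlt
  have hle : ∀ s, π s * expWeight (n + 1) (Fin.cons η₀ (fun _ => η₁)) s ≤
      π s * ∑ j, Real.exp ((n + 1) * r * queueLen (n + 1) s j) := fun s => by
    by_cases h : π s = 0
    · simp [h]
    · exact mul_le_mul_of_nonneg_left
        (expWeight_le_sum_exp hn (by positivity) (by linarith) (by linarith) (hπsupp s h)) (hπnn s)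
  have hfin := Summable.of_nonneg_of_le
    (fun s => mul_nonneg (hπnn s) (Real.exp_pos _).le) hle hsum
  exact hfin.tsum_ofReal_lt_top
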